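/- arXiv:1104.4779 — 5 statements merged into one kernel-verified Lean document; each statement's English description precedes it below -/
import Mathlib

section
/- Let g : {0,1,3} → {0,1,3} be a map that preserves each of the four relations S1, S2, S3, S4. Then g is the identity map on {0,1,3}. (In particular, the relational structure D is a core: every endomorphism of D is an automorphism.) -/
namespace Paper

/-- The relation `S1 = {(0,3),(1,1),(3,1),(3,3)}`. -/
def S1 : Set (ℕ × ℕ) := {(0, 3), (1, 1), (3, 1), (3, 3)}

/-- The relation `S2 = {(1,0),(1,1),(3,1),(3,3)}`. -/
def S2 : Set (ℕ × ℕ) := {(1, 0), (1, 1), (3, 1), (3, 3)}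

/-- The relation `S3 = {(1,3),(3,1),(3,3)}`. -/
def S3 : Set (ℕ × ℕ) := {(1, 3), (3, 1), (3, 3)}

/-- The relation `S4 = {(1,1),(1,3),(3,1)}`. -/
def S4 : Set (ℕ × ℕ) := {(1, 1), (1, 3), (3, 1)}

/-- The domain `{0,1,3}` of the structure `D`. -/
def Dom : Set ℕ := {0, 1, 3}

/-- Every unary map on `{0,1,3}` preserving `S1, S2, S3, S4` is the identity
on `{0,1,3}`; in particular the structure `D` is a core. -/
theorem stmt0 (g : ℕ → ℕ)
    (hdom : ∀ a ∈ Dom, g a ∈ Dom)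
    (h1 : ∀ a b : ℕ, (a, b) ∈ S1 → (g a, g b) ∈ S1)
    (h2 : ∀ a b : ℕ, (a, b) ∈ S2 → (g a, g b) ∈ S2)
    (h3 : ∀ a b : ℕ, (a, b) ∈ S3 → (g a, g b) ∈ S3)
    (h4 : ∀ a b : ℕ, (a, b) ∈ S4 → (g a, g b) ∈ S4) :
    ∀ a ∈ Dom, g a = a := by
  have g_one : g 1 = 1 := by
    have h := h4 1 1 (by simp [S4])
    simp [S4] at h
    omega
  have g_three : g 3 = 3 := by
    have h := h3 3 3 (by simp [S3])
    simp [S3] at h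
    omega
  have g_zero : g 0 = 0 := by
    have h := h1 0 3 (by simp [S1])
    have h' := h2 1 0 (by simp [S2])
    simp [S1, g_three] at h
    simp [S2, g_one] at h'
    omega
  rintro a (rfl | rfl | rfl)
  exacts [g_zero, g_one, g_three]

end Paper
end

section
/- There is no ternary map f : {0,1,3}³ → {0,1,3} that preserves each of S1, S2, S3, S4 and satisfies f(i,j,j)=f(j,j,i)=i for all i,j∈{1,3}. In particular, no ternary polymorphism of the structure D restricts to a Mal'tsev operation on {1,3}. -/
namespace Paper

/-- No ternary map on `{0,1,3}` preserving `S1, S2, S3, S4` satisfies the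
Mal'tsev identities `f(i,j,j)=f(j,j,i)=i` for all `i,j ∈ {1,3}`; in particular
no ternary polymorphism of `D` restricts to a Mal'tsev operation on `{1,3}`. -/
theorem stmt2 :
    ¬ ∃ f : ℕ → ℕ → ℕ → ℕ,
      (∀ a ∈ Dom, ∀ b ∈ Dom, ∀ c ∈ Dom, f a b c ∈ Dom) ∧
      (∀ a b a' b' a'' b'' : ℕ, (a, b) ∈ S1 → (a', b') ∈ S1 → (a'', b'') ∈ S1 →
        (f a a' a'', f b b' b'') ∈ S1) ∧
      (∀ a b a' b' a'' b'' : ℕ, (a, b) ∈ S2 → (a', b') ∈ S2 → (a'', b'') ∈ S2 →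
        (f a a' a'', f b b' b'') ∈ S2) ∧
      (∀ a b a' b' a'' b'' : ℕ, (a, b) ∈ S3 → (a', b') ∈ S3 → (a'', b'') ∈ S3 →
        (f a a' a'', f b b' b'') ∈ S3) ∧
      (∀ a b a' b' a'' b'' : ℕ, (a, b) ∈ S4 → (a', b') ∈ S4 → (a'', b'') ∈ S4 →
        (f a a' a'', f b b' b'') ∈ S4) ∧
      (∀ i ∈ ({1, 3} : Set ℕ), ∀ j ∈ ({1, 3} : Set ℕ),
        f i j j = i ∧ f j j i = i) := by
  rintro ⟨f, -, h, -, -, -, malt⟩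
  have h1 : f 1 3 3 = 1 := (malt 1 (by simp) 3 (by simp)).1
  have h2 : f 1 1 3 = 3 := (malt 3 (by simp) 1 (by simp)).2
  have h3 := h 1 1 3 1 3 3 (by simp [S1]) (by simp [S1]) (by simp [S1])
  simp [h1, h2, S1] at h3

end Paper
end

section
/- Let A=(A;R1,R2,R3,R4) be an instance and let G be its D-graph. Then G is connected and has diameter exactly 2; that is, G is not a complete graph, and any two distinct non-adjacent vertices of G have a common neighbor. -/
namespace Paper

/-- An instance: four binary relations on a set `α` such that every element
occurs in at least one pair of `R1 ∪ R2 ∪ R3 ∪ R4`. -/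
structure Inst (α : Type) : Type where
  R1 : Set (α × α)
  R2 : Set (α × α)
  R3 : Set (α × α)
  R4 : Set (α × α)
  cover : ∀ a : α, (∃ b, (a, b) ∈ R1 ∪ R2 ∪ R3 ∪ R4) ∨
    (∃ b, (b, a) ∈ R1 ∪ R2 ∪ R3 ∪ R4)

variable {α : Type}

/-- The set `L` of elements occurring as a first coordinate. -/
def Inst.L (I : Inst α) : Set α :=
  {p | ∃ q, (p, q) ∈ I.R1 ∪ I.R2 ∪ I.R3 ∪ I.R4}

/-- The set `R` of elements occurring as a second coordinate. -/
def Inst.Rs (I : Inst α) : Set α :=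
  {q | ∃ p, (p, q) ∈ I.R1 ∪ I.R2 ∪ I.R3 ∪ I.R4}

/-- The non-`H` vertices of the D-graph: the elements of `A`, the vertices
`a_p, b_p` for `p ∈ L` and the vertices `c_q, d_q` for `q ∈ R`. -/
abbrev Core (I : Inst α) : Type := α ⊕ ↥I.L ⊕ ↥I.L ⊕ ↥I.Rs ⊕ ↥I.Rs

/-- The vertex set of the D-graph: `h0,h1,h2,h3` (indexed by `ZMod 4`)
together with the non-`H` vertices. -/
abbrev DVert (I : Inst α) : Type := ZMod 4 ⊕ Core I

def ce (I : Inst α) (a : α) : Core I := Sum.inl a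
def ca (I : Inst α) (p : ↥I.L) : Core I := Sum.inr (Sum.inl p)
def cb (I : Inst α) (p : ↥I.L) : Core I := Sum.inr (Sum.inr (Sum.inl p))
def cc (I : Inst α) (q : ↥I.Rs) : Core I := Sum.inr (Sum.inr (Sum.inr (Sum.inl q)))
def cd (I : Inst α) (q : ↥I.Rs) : Core I := Sum.inr (Sum.inr (Sum.inr (Sum.inr q)))

/-- The vertex `h_i`. -/
def hv (I : Inst α) (i : ZMod 4) : DVert I := Sum.inl i
/-- The vertex corresponding to an element `a ∈ A`. -/
def ev (I : Inst α) (a : α) : DVert I := Sum.inr (ce I a)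
/-- The vertex `a_p` for `p ∈ L`. -/
def av (I : Inst α) (p : ↥I.L) : DVert I := Sum.inr (ca I p)
/-- The vertex `b_p` for `p ∈ L`. -/
def bv (I : Inst α) (p : ↥I.L) : DVert I := Sum.inr (cb I p)
/-- The vertex `c_q` for `q ∈ R`. -/
def cv (I : Inst α) (q : ↥I.Rs) : DVert I := Sum.inr (cc I q)
/-- The vertex `d_q` for `q ∈ R`. -/
def dv (I : Inst α) (q : ↥I.Rs) : DVert I := Sum.inr (cd I q)

/-- The (directed) list of edges of the D-graph. -/
def dBase (I : Inst α) : DVert I → DVert I → Prop := fun u v =>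
  (∃ i : ZMod 4, u = hv I i ∧ v = hv I (i + 1)) ∨
  (∃ p : ↥I.L,
    (u = av I p ∧ v = ev I ↑p) ∨ (u = bv I p ∧ v = ev I ↑p) ∨
    (u = av I p ∧ v = bv I p) ∨ (u = av I p ∧ v = hv I 0) ∨
    (u = av I p ∧ v = hv I 3) ∨ (u = bv I p ∧ v = hv I 1) ∨
    (u = bv I p ∧ v = hv I 2)) ∨
  (∃ q : ↥I.Rs,
    (u = cv I q ∧ v = ev I ↑q) ∨ (u = dv I q ∧ v = ev I ↑q) ∨
    (u = cv I q ∧ v = dv I q) ∨ (u = cv I q ∧ v = hv I 2) ∨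
    (u = cv I q ∧ v = hv I 3) ∨ (u = dv I q ∧ v = hv I 0) ∨
    (u = dv I q ∧ v = hv I 1)) ∨
  (∃ a : α, u = hv I 0 ∧ v = ev I a) ∨
  (∃ p q, (p, q) ∈ I.R1 ∧ ∃ hq : q ∈ I.Rs,
    ((u = cv I ⟨q, hq⟩ ∧ v = ev I p) ∨ (u = ev I q ∧ v = hv I 2))) ∨
  (∃ p q, (p, q) ∈ I.R2 ∧ ∃ hp : p ∈ I.L,
    ((u = ev I p ∧ v = hv I 2) ∨ (u = bv I ⟨p, hp⟩ ∧ v = ev I q))) ∨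
  (∃ p q, (p, q) ∈ I.R3 ∧ ∃ hp : p ∈ I.L, ∃ hq : q ∈ I.Rs,
    ((u = ev I p ∧ v = hv I 2) ∨ (u = ev I q ∧ v = hv I 2) ∨
     (u = av I ⟨p, hp⟩ ∧ v = cv I ⟨q, hq⟩))) ∨
  (∃ p q, (p, q) ∈ I.R4 ∧ ∃ hp : p ∈ I.L, ∃ hq : q ∈ I.Rs,
    ((u = ev I p ∧ v = hv I 2) ∨ (u = ev I q ∧ v = hv I 2) ∨
     (u = bv I ⟨p, hp⟩ ∧ v = dv I ⟨q, hq⟩))) ∨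
  (∃ p p' : ↥I.L, p ≠ p' ∧
    ((u = av I p ∧ v = av I p') ∨ (u = bv I p ∧ v = bv I p'))) ∨
  (∃ q q' : ↥I.Rs, q ≠ q' ∧
    ((u = cv I q ∧ v = cv I q') ∨ (u = dv I q ∧ v = dv I q')))

/-- The D-graph of an instance: the simple graph whose edges are exactly
the (symmetrised) pairs listed in `dBase`. -/
def DGraph (I : Inst α) : SimpleGraph (DVert I) := SimpleGraph.fromRel (dBase I)

/-- Adjacency in the reflexive 4-cycle `H` between *distinct* vertices
(`h_i h_{i+1}` cycle edges), vertices indexed by `ZMod 4`. -/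
def C4adj (x y : ZMod 4) : Prop := y = x + 1 ∨ x = y + 1

/-- A homomorphism from a simple graph `G` to the reflexive 4-cycle `H`:
every edge is mapped to a self-loop or to a cycle edge of `H`. -/
def IsHomC4 {V : Type} (G : SimpleGraph V) (f : V → ZMod 4) : Prop :=
  ∀ u v : V, G.Adj u v → f u = f v ∨ C4adj (f u) (f v)

/-- A retraction from the D-graph to `H`: a homomorphism fixing `h0,…,h3`. -/
def DRetr (I : Inst α) (g : DVert I → ZMod 4) : Prop :=
  IsHomC4 (DGraph I) g ∧ ∀ i : ZMod 4, g (hv I i) = i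

/-- A homomorphism from the instance `I` to the structure `D`. -/
def InstHom (I : Inst α) (f : α → ℕ) : Prop :=
  (∀ a : α, f a ∈ Dom) ∧
  (∀ p q, (p, q) ∈ I.R1 → (f p, f q) ∈ S1) ∧
  (∀ p q, (p, q) ∈ I.R2 → (f p, f q) ∈ S2) ∧
  (∀ p q, (p, q) ∈ I.R3 → (f p, f q) ∈ S3) ∧
  (∀ p q, (p, q) ∈ I.R4 → (f p, f q) ∈ S4)

namespace Inst

theorem adj_hv_hv_add_one (I : Inst α) (i : ZMod 4) :
    (DGraph I).Adj (hv I i) (hv I (i + 1)) := by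
  refine (SimpleGraph.fromRel_adj _ _ _).2 ⟨?_, Or.inl (Or.inl ⟨i, rfl, rfl⟩)⟩
  intro h
  have h' : i = i + 1 := Sum.inl_injective h
  exact (by decide : ∀ i : ZMod 4, i ≠ i + 1) i h'

theorem adj_av_ev (I : Inst α) (p : I.L) : (DGraph I).Adj (av I p) (ev I p) :=
  (SimpleGraph.fromRel_adj _ _ _).2
    ⟨by simp [av, ev, ca, ce], Or.inl (Or.inr (Or.inl ⟨p, by simp⟩))⟩

theorem adj_bv_ev (I : Inst α) (p : I.L) : (DGraph I).Adj (bv I p) (ev I p) :=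
  (SimpleGraph.fromRel_adj _ _ _).2
    ⟨by simp [bv, ev, cb, ce], Or.inl (Or.inr (Or.inl ⟨p, by simp⟩))⟩

theorem adj_av_bv (I : Inst α) (p : I.L) : (DGraph I).Adj (av I p) (bv I p) :=
  (SimpleGraph.fromRel_adj _ _ _).2
    ⟨by simp [av, bv, ca, cb], Or.inl (Or.inr (Or.inl ⟨p, by simp⟩))⟩

theorem adj_av_hv (I : Inst α) (p : I.L) {i : ZMod 4} (hi : i = 0 ∨ i = 3) :
    (DGraph I).Adj (av I p) (hv I i) :=
  (SimpleGraph.fromRel_adj _ _ _).2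
    ⟨by simp [av, hv], Or.inl (Or.inr (Or.inl ⟨p, by rcases hi with rfl | rfl <;> simp⟩))⟩

theorem adj_bv_hv (I : Inst α) (p : I.L) {i : ZMod 4} (hi : i = 1 ∨ i = 2) :
    (DGraph I).Adj (bv I p) (hv I i) :=
  (SimpleGraph.fromRel_adj _ _ _).2
    ⟨by simp [bv, hv], Or.inl (Or.inr (Or.inl ⟨p, by rcases hi with rfl | rfl <;> simp⟩))⟩

theorem adj_cv_ev (I : Inst α) (q : I.Rs) : (DGraph I).Adj (cv I q) (ev I q) :=
  (SimpleGraph.fromRel_adj _ _ _).2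
    ⟨by simp [cv, ev, cc, ce], Or.inl (Or.inr (Or.inr (Or.inl ⟨q, by simp⟩)))⟩

theorem adj_cv_dv (I : Inst α) (q : I.Rs) : (DGraph I).Adj (cv I q) (dv I q) :=
  (SimpleGraph.fromRel_adj _ _ _).2
    ⟨by simp [cv, dv, cc, cd], Or.inl (Or.inr (Or.inr (Or.inl ⟨q, by simp⟩)))⟩

theorem adj_cv_hv (I : Inst α) (q : I.Rs) {i : ZMod 4} (hi : i = 2 ∨ i = 3) :
    (DGraph I).Adj (cv I q) (hv I i) :=
  (SimpleGraph.fromRel_adj _ _ _).2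
    ⟨by simp [cv, hv],
      Or.inl (Or.inr (Or.inr (Or.inl ⟨q, by rcases hi with rfl | rfl <;> simp⟩)))⟩

theorem adj_dv_hv (I : Inst α) (q : I.Rs) {i : ZMod 4} (hi : i = 0 ∨ i = 1) :
    (DGraph I).Adj (dv I q) (hv I i) :=
  (SimpleGraph.fromRel_adj _ _ _).2
    ⟨by simp [dv, hv],
      Or.inl (Or.inr (Or.inr (Or.inl ⟨q, by rcases hi with rfl | rfl <;> simp⟩)))⟩

theorem adj_ev_hv_zero (I : Inst α) (a : α) : (DGraph I).Adj (ev I a) (hv I 0) :=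
  (SimpleGraph.fromRel_adj _ _ _).2
    ⟨by simp [ev, hv], Or.inr (Or.inr (Or.inr (Or.inr (Or.inl ⟨a, rfl, rfl⟩))))⟩

theorem eq_or_adj_av (I : Inst α) (p p' : I.L) :
    av I p = av I p' ∨ (DGraph I).Adj (av I p) (av I p') := by
  by_cases h : p = p'
  · exact Or.inl (h ▸ rfl)
  · refine Or.inr ((SimpleGraph.fromRel_adj _ _ _).2 ⟨by simpa [av, ca] using h, Or.inl ?_⟩)
    exact Or.inr (Or.inr (Or.inr (Or.inr (Or.inr (Or.inr (Or.inr (Or.inr (Or.inl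
      ⟨p, p', h, Or.inl ⟨rfl, rfl⟩⟩))))))))

theorem eq_or_adj_bv (I : Inst α) (p p' : I.L) :
    bv I p = bv I p' ∨ (DGraph I).Adj (bv I p) (bv I p') := by
  by_cases h : p = p'
  · exact Or.inl (h ▸ rfl)
  · refine Or.inr ((SimpleGraph.fromRel_adj _ _ _).2 ⟨by simpa [bv, cb] using h, Or.inl ?_⟩)
    exact Or.inr (Or.inr (Or.inr (Or.inr (Or.inr (Or.inr (Or.inr (Or.inr (Or.inl
      ⟨p, p', h, Or.inr ⟨rfl, rfl⟩⟩))))))))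

theorem eq_or_adj_cv (I : Inst α) (q q' : I.Rs) :
    cv I q = cv I q' ∨ (DGraph I).Adj (cv I q) (cv I q') := by
  by_cases h : q = q'
  · exact Or.inl (h ▸ rfl)
  · refine Or.inr ((SimpleGraph.fromRel_adj _ _ _).2 ⟨by simpa [cv, cc] using h, Or.inl ?_⟩)
    exact Or.inr (Or.inr (Or.inr (Or.inr (Or.inr (Or.inr (Or.inr (Or.inr (Or.inr
      ⟨q, q', h, Or.inl ⟨rfl, rfl⟩⟩))))))))

/-- An element of `R` is adjacent to `h2` or to some vertex `b_p`. -/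
theorem adj_h2_or_bv (I : Inst α) {x : α} (hx : x ∈ I.Rs) :
    (DGraph I).Adj (ev I x) (hv I 2) ∨ ∃ p, (DGraph I).Adj (ev I x) (bv I p) := by
  have hne : ev I x ≠ hv I 2 := by simp [ev, hv]
  have hne' : ∀ p, ev I x ≠ bv I p := by simp [ev, bv, ce, cb]
  have h2 (h : dBase I (ev I x) (hv I 2)) : (DGraph I).Adj (ev I x) (hv I 2) :=
    (SimpleGraph.fromRel_adj _ _ _).2 ⟨hne, Or.inl h⟩
  obtain ⟨p, hp⟩ := id hx
  have hpL : p ∈ I.L := ⟨x, hp⟩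
  obtain ((h | h) | h) | h := hp
  · exact Or.inl (h2 (Or.inr (Or.inr (Or.inr (Or.inr (Or.inl
      ⟨p, x, h, hx, Or.inr ⟨rfl, rfl⟩⟩))))))
  · exact Or.inr ⟨⟨p, hpL⟩, (SimpleGraph.fromRel_adj _ _ _).2 ⟨hne' _, Or.inr
      (Or.inr (Or.inr (Or.inr (Or.inr (Or.inr (Or.inl
        ⟨p, x, h, hpL, Or.inr ⟨rfl, rfl⟩⟩))))))⟩⟩
  · exact Or.inl (h2 (Or.inr (Or.inr (Or.inr (Or.inr (Or.inr (Or.inr (Or.inl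
      ⟨p, x, h, hpL, hx, Or.inr (Or.inl ⟨rfl, rfl⟩)⟩))))))))
  · exact Or.inl (h2 (Or.inr (Or.inr (Or.inr (Or.inr (Or.inr (Or.inr (Or.inr (Or.inl
      ⟨p, x, h, hpL, hx, Or.inr (Or.inl ⟨rfl, rfl⟩)⟩)))))))))

/-- An element of `L` is adjacent to `h2` or to some vertex `c_q`. -/
theorem adj_h2_or_cv (I : Inst α) {x : α} (hx : x ∈ I.L) :
    (DGraph I).Adj (ev I x) (hv I 2) ∨ ∃ q, (DGraph I).Adj (ev I x) (cv I q) := by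
  have hne : ev I x ≠ hv I 2 := by simp [ev, hv]
  have hne' : ∀ q, ev I x ≠ cv I q := by simp [ev, cv, ce, cc]
  have h2 (h : dBase I (ev I x) (hv I 2)) : (DGraph I).Adj (ev I x) (hv I 2) :=
    (SimpleGraph.fromRel_adj _ _ _).2 ⟨hne, Or.inl h⟩
  obtain ⟨q, hq⟩ := id hx
  have hqR : q ∈ I.Rs := ⟨x, hq⟩
  obtain ((h | h) | h) | h := hq
  · exact Or.inr ⟨⟨q, hqR⟩, (SimpleGraph.fromRel_adj _ _ _).2 ⟨hne' _, Or.inr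
      (Or.inr (Or.inr (Or.inr (Or.inr (Or.inl ⟨x, q, h, hqR, Or.inl ⟨rfl, rfl⟩⟩)))))⟩⟩
  · exact Or.inl (h2 (Or.inr (Or.inr (Or.inr (Or.inr (Or.inr (Or.inl
      ⟨x, q, h, hx, Or.inl ⟨rfl, rfl⟩⟩)))))))
  · exact Or.inl (h2 (Or.inr (Or.inr (Or.inr (Or.inr (Or.inr (Or.inr (Or.inl
      ⟨x, q, h, hx, hqR, Or.inl ⟨rfl, rfl⟩⟩))))))))
  · exact Or.inl (h2 (Or.inr (Or.inr (Or.inr (Or.inr (Or.inr (Or.inr (Or.inr (Or.inl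
      ⟨x, q, h, hx, hqR, Or.inl ⟨rfl, rfl⟩⟩)))))))))

theorem not_adj_h0_h2 (I : Inst α) : ¬ (DGraph I).Adj (hv I 0) (hv I 2) := by
  intro h
  have key : ¬ ∃ i : ZMod 4, (0 = i ∧ 2 = i + 1) ∨ (2 = i ∧ 0 = i + 1) := by decide
  obtain ⟨-, h | h⟩ := (SimpleGraph.fromRel_adj _ _ _).1 h
  · refine key ?_
    simp only [dBase, hv, av, bv, cv, dv, ev, Sum.inl.injEq, reduceCtorEq, false_and, and_false,
      or_false, exists_false] at h
    exact h.imp fun _ => Or.inl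
  · refine key ?_
    simp only [dBase, hv, av, bv, cv, dv, ev, Sum.inl.injEq, reduceCtorEq, false_and, and_false,
      or_false, exists_false] at h
    exact h.imp fun _ => Or.inr

/-- Two vertices of the D-graph are within distance two: they are equal, adjacent,
or have a common neighbour. -/
def Near (I : Inst α) (u v : DVert I) : Prop :=
  u = v ∨ (DGraph I).Adj u v ∨ ∃ w, (DGraph I).Adj u w ∧ (DGraph I).Adj v w

theorem Near.symm {I : Inst α} {u v : DVert I} (h : I.Near u v) : I.Near v u := by
  obtain h | h | ⟨w, hu, hv⟩ := h
  · exact Or.inl h.symm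
  · exact Or.inr (Or.inl h.symm)
  · exact Or.inr (Or.inr ⟨w, hv, hu⟩)

theorem near_of_adj_of_adj {I : Inst α} {u v : DVert I} (w : DVert I)
    (hu : (DGraph I).Adj u w) (hv : (DGraph I).Adj v w) : I.Near u v :=
  Or.inr (Or.inr ⟨w, hu, hv⟩)

theorem near_of_adj_of_eq_or_adj {I : Inst α} {u v w : DVert I}
    (hu : (DGraph I).Adj u w) (hv : v = w ∨ (DGraph I).Adj v w) : I.Near u v := by
  obtain rfl | hv := hv
  · exact Or.inr (Or.inl hu)
  · exact near_of_adj_of_adj w hu hv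

theorem eq_or_consecutive (i j : ZMod 4) :
    i = j ∨ i = j + 1 ∨ i = j + 1 + 1 ∨ i + 1 = j := by
  decide +revert

/-- A vertex adjacent to two consecutive vertices of the 4-cycle is near all of them. -/
theorem near_hv_of_adj {I : Inst α} {u : DVert I} (j : ZMod 4)
    (h₀ : (DGraph I).Adj u (hv I j)) (h₁ : (DGraph I).Adj u (hv I (j + 1))) (i : ZMod 4) :
    I.Near u (hv I i) := by
  obtain rfl | rfl | rfl | rfl := eq_or_consecutive i j
  · exact Or.inr (Or.inl h₀)
  · exact Or.inr (Or.inl h₁)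
  · exact near_of_adj_of_adj _ h₁ (I.adj_hv_hv_add_one _).symm
  · exact near_of_adj_of_adj _ h₀ (I.adj_hv_hv_add_one _)

theorem mem_L_or_mem_Rs (I : Inst α) (a : α) : a ∈ I.L ∨ a ∈ I.Rs := I.cover a

theorem near_hv_hv (I : Inst α) (i j : ZMod 4) : I.Near (hv I i) (hv I j) := by
  obtain rfl | rfl | rfl | rfl := eq_or_consecutive j i
  · exact Or.inl rfl
  · exact Or.inr (Or.inl (I.adj_hv_hv_add_one _))
  · exact near_of_adj_of_adj _ (I.adj_hv_hv_add_one _) (I.adj_hv_hv_add_one _).symm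
  · exact Or.inr (Or.inl (I.adj_hv_hv_add_one _).symm)

theorem near_ev_hv (I : Inst α) (a : α) (i : ZMod 4) : I.Near (ev I a) (hv I i) := by
  obtain rfl | rfl | rfl | hi := eq_or_consecutive i 0
  · exact Or.inr (Or.inl (I.adj_ev_hv_zero a))
  · exact near_of_adj_of_adj _ (I.adj_ev_hv_zero a) (I.adj_hv_hv_add_one _).symm
  · obtain ha | ha := I.mem_L_or_mem_Rs a
    · exact near_of_adj_of_adj _ (I.adj_bv_ev ⟨a, ha⟩).symm
        (I.adj_bv_hv _ (Or.inr rfl)).symm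
    · exact near_of_adj_of_adj _ (I.adj_cv_ev ⟨a, ha⟩).symm
        (I.adj_cv_hv _ (Or.inl rfl)).symm
  · exact near_of_adj_of_adj _ (I.adj_ev_hv_zero a) (hi ▸ I.adj_hv_hv_add_one i)

theorem near_av_hv (I : Inst α) (p : I.L) (i : ZMod 4) : I.Near (av I p) (hv I i) :=
  near_hv_of_adj 3 (I.adj_av_hv p (by decide)) (I.adj_av_hv p (by decide)) i

theorem near_bv_hv (I : Inst α) (p : I.L) (i : ZMod 4) : I.Near (bv I p) (hv I i) :=
  near_hv_of_adj 1 (I.adj_bv_hv p (by decide)) (I.adj_bv_hv p (by decide)) i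

theorem near_cv_hv (I : Inst α) (q : I.Rs) (i : ZMod 4) : I.Near (cv I q) (hv I i) :=
  near_hv_of_adj 2 (I.adj_cv_hv q (by decide)) (I.adj_cv_hv q (by decide)) i

theorem near_dv_hv (I : Inst α) (q : I.Rs) (i : ZMod 4) : I.Near (dv I q) (hv I i) :=
  near_hv_of_adj 0 (I.adj_dv_hv q (by decide)) (I.adj_dv_hv q (by decide)) i

theorem near_ev_bv (I : Inst α) (x : α) (p : I.L) : I.Near (ev I x) (bv I p) := by
  obtain hx | hx := I.mem_L_or_mem_Rs x
  · exact near_of_adj_of_eq_or_adj (I.adj_bv_ev ⟨x, hx⟩).symm (I.eq_or_adj_bv _ _)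
  · obtain h | ⟨p', h⟩ := I.adj_h2_or_bv hx
    · exact near_of_adj_of_adj _ h (I.adj_bv_hv p (Or.inr rfl))
    · exact near_of_adj_of_eq_or_adj h (I.eq_or_adj_bv _ _)

theorem near_ev_cv (I : Inst α) (x : α) (q : I.Rs) : I.Near (ev I x) (cv I q) := by
  obtain hx | hx := I.mem_L_or_mem_Rs x
  · obtain h | ⟨q', h⟩ := I.adj_h2_or_cv hx
    · exact near_of_adj_of_adj _ h (I.adj_cv_hv q (Or.inl rfl))
    · exact near_of_adj_of_eq_or_adj h (I.eq_or_adj_cv _ _)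
  · exact near_of_adj_of_eq_or_adj (I.adj_cv_ev ⟨x, hx⟩).symm (I.eq_or_adj_cv _ _)

theorem near_ev (I : Inst α) (x : α) (v : DVert I) : I.Near (ev I x) v := by
  have h := I.adj_ev_hv_zero x
  rcases v with i | y | p | p | q | q
  · exact I.near_ev_hv x i
  · exact near_of_adj_of_adj _ h (I.adj_ev_hv_zero y)
  · exact near_of_adj_of_adj _ h (I.adj_av_hv p (Or.inl rfl))
  · exact I.near_ev_bv x p
  · exact I.near_ev_cv x q
  · exact near_of_adj_of_adj _ h (I.adj_dv_hv q (Or.inl rfl))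

theorem near_av_bv (I : Inst α) (p p' : I.L) : I.Near (av I p) (bv I p') :=
  near_of_adj_of_eq_or_adj (I.adj_av_bv p) (I.eq_or_adj_bv _ _)

theorem near_av_cv (I : Inst α) (p : I.L) (q : I.Rs) : I.Near (av I p) (cv I q) :=
  near_of_adj_of_adj (hv I 3) (I.adj_av_hv p (Or.inr rfl)) (I.adj_cv_hv q (Or.inr rfl))

theorem near_av_dv (I : Inst α) (p : I.L) (q : I.Rs) : I.Near (av I p) (dv I q) :=
  near_of_adj_of_adj (hv I 0) (I.adj_av_hv p (Or.inl rfl)) (I.adj_dv_hv q (Or.inl rfl))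

theorem near_bv_cv (I : Inst α) (p : I.L) (q : I.Rs) : I.Near (bv I p) (cv I q) :=
  near_of_adj_of_adj (hv I 2) (I.adj_bv_hv p (Or.inr rfl)) (I.adj_cv_hv q (Or.inl rfl))

theorem near_bv_dv (I : Inst α) (p : I.L) (q : I.Rs) : I.Near (bv I p) (dv I q) :=
  near_of_adj_of_adj (hv I 1) (I.adj_bv_hv p (Or.inl rfl)) (I.adj_dv_hv q (Or.inr rfl))

theorem near_dv_cv (I : Inst α) (q q' : I.Rs) : I.Near (dv I q) (cv I q') :=
  near_of_adj_of_eq_or_adj (I.adj_cv_dv q).symm (I.eq_or_adj_cv _ _)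

theorem near (I : Inst α) (u v : DVert I) : I.Near u v := by
  rcases u with i | x | p | p | q | q
  · rcases v with j | y | p' | p' | q' | q'
    · exact I.near_hv_hv i j
    · exact (I.near_ev y _).symm
    · exact (I.near_av_hv p' i).symm
    · exact (I.near_bv_hv p' i).symm
    · exact (I.near_cv_hv q' i).symm
    · exact (I.near_dv_hv q' i).symm
  · exact I.near_ev x v
  · rcases v with j | y | p' | p' | q' | q'
    · exact I.near_av_hv p j
    · exact (I.near_ev y _).symm
    · exact near_of_adj_of_adj _ (I.adj_av_hv p (Or.inl rfl)) (I.adj_av_hv p' (Or.inl rfl))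
    · exact I.near_av_bv p p'
    · exact I.near_av_cv p q'
    · exact I.near_av_dv p q'
  · rcases v with j | y | p' | p' | q' | q'
    · exact I.near_bv_hv p j
    · exact (I.near_ev y _).symm
    · exact (I.near_av_bv p' p).symm
    · exact near_of_adj_of_adj _ (I.adj_bv_hv p (Or.inl rfl)) (I.adj_bv_hv p' (Or.inl rfl))
    · exact I.near_bv_cv p q'
    · exact I.near_bv_dv p q'
  · rcases v with j | y | p' | p' | q' | q'
    · exact I.near_cv_hv q j
    · exact (I.near_ev y _).symm
    · exact (I.near_av_cv p' q).symm
    · exact (I.near_bv_cv p' q).symm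
    · exact near_of_adj_of_adj _ (I.adj_cv_hv q (Or.inl rfl)) (I.adj_cv_hv q' (Or.inl rfl))
    · exact (I.near_dv_cv q' q).symm
  · rcases v with j | y | p' | p' | q' | q'
    · exact I.near_dv_hv q j
    · exact (I.near_ev y _).symm
    · exact (I.near_av_dv p' q).symm
    · exact (I.near_bv_dv p' q).symm
    · exact I.near_dv_cv q q'
    · exact near_of_adj_of_adj _ (I.adj_dv_hv q (Or.inl rfl)) (I.adj_dv_hv q' (Or.inl rfl))

theorem connected_dGraph (I : Inst α) : (DGraph I).Connected where
  preconnected u v := by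
    obtain rfl | h | ⟨w, hu, hv⟩ := I.near u v
    · exact SimpleGraph.Reachable.refl _
    · exact h.reachable
    · exact hu.reachable.trans hv.symm.reachable
  nonempty := ⟨hv I 0⟩

end Inst

/-- The D-graph of any instance is connected and has diameter exactly 2:
it is not complete, and any two distinct non-adjacent vertices have a
common neighbour. -/
theorem stmt5 (α : Type) [Fintype α] (I : Inst α) :
    (DGraph I).Connected ∧
    (¬ ∀ u v : DVert I, u ≠ v → (DGraph I).Adj u v) ∧
    (∀ u v : DVert I, u ≠ v → ¬ (DGraph I).Adj u v →
      ∃ w : DVert I, (DGraph I).Adj u w ∧ (DGraph I).Adj v w) := by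
  refine ⟨I.connected_dGraph, fun h => I.not_adj_h0_h2 (h _ _ ?_), fun u v hne hadj => ?_⟩
  · intro h
    have h' : (0 : ZMod 4) = 2 := Sum.inl_injective h
    revert h'
    decide
  · exact ((I.near u v).resolve_left hne).resolve_left hadj

end Paper
end

section
/- Let A=(A;R1,R2,R3,R4) be an instance and let G be its D-graph. If there exists a homomorphism from A to D, i.e. a map f : A → {0,1,3} such that (f(p),f(q))∈S_i whenever (p,q)∈R_i for i=1,2,3,4, then G retracts to the reflexive 4-cycle H on its distinguished vertices h0,h1,h2,h3. -/
namespace Paper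

variable {α : Type}

/-- Equality or adjacency in the 4-cycle: the edge relation of the reflexive 4-cycle. -/
def ReflC4 (x y : ZMod 4) : Prop := x = y ∨ y = x + 1 ∨ x = y + 1

instance : DecidableRel ReflC4 := fun x y =>
  inferInstanceAs (Decidable (x = y ∨ y = x + 1 ∨ x = y + 1))

lemma ReflC4.symm {x y : ZMod 4} (h : ReflC4 x y) : ReflC4 y x := by
  rcases h with h | h | h
  exacts [.inl h.symm, .inr (.inr h), .inr (.inl h)]

/-- The retraction induced by `f`: `a_p, b_p` go to `h3, h2` or to `h0, h1` according to whether
`f p = 3`, and `c_q, d_q` go to `h2, h1` or to `h3, h0` according to whether `f q = 1`. -/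
def retractionOf (I : Inst α) (f : α → ℕ) : DVert I → ZMod 4
  | .inl i => i
  | .inr (.inl x) => (f x : ZMod 4)
  | .inr (.inr (.inl p)) => if f p = 3 then 3 else 0
  | .inr (.inr (.inr (.inl p))) => if f p = 3 then 2 else 1
  | .inr (.inr (.inr (.inr (.inl q)))) => if f q = 1 then 2 else 3
  | .inr (.inr (.inr (.inr (.inr q)))) => if f q = 1 then 1 else 0

section
variable (I : Inst α) (f : α → ℕ)

lemma retractionOf_hv (i : ZMod 4) : retractionOf I f (hv I i) = i := rfl

lemma retractionOf_ev (x : α) : retractionOf I f (ev I x) = (f x : ZMod 4) := rfl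

lemma retractionOf_av (p : ↥I.L) : retractionOf I f (av I p) = if f p = 3 then 3 else 0 := rfl

lemma retractionOf_bv (p : ↥I.L) : retractionOf I f (bv I p) = if f p = 3 then 2 else 1 := rfl

lemma retractionOf_cv (q : ↥I.Rs) : retractionOf I f (cv I q) = if f q = 1 then 2 else 3 := rfl

lemma retractionOf_dv (q : ↥I.Rs) : retractionOf I f (dv I q) = if f q = 1 then 1 else 0 := rfl

end

lemma reflC4_retractionOf_of_dBase {I : Inst α} {f : α → ℕ} (hf : InstHom I f) {u v : DVert I}
    (h : dBase I u v) : ReflC4 (retractionOf I f u) (retractionOf I f v) := by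
  obtain ⟨hD, h1, h2, h3, h4⟩ := hf
  simp only [Dom, S1, S2, S3, S4, Set.mem_insert_iff, Set.mem_singleton_iff, Prod.mk.injEq]
    at hD h1 h2 h3 h4
  rcases h with ⟨i, rfl, rfl⟩ | ⟨p, h⟩ | ⟨q, h⟩ | ⟨x, rfl, rfl⟩ | ⟨p, q, hR, hq, h⟩ |
    ⟨p, q, hR, hp, h⟩ | ⟨p, q, hR, hp, hq, h⟩ | ⟨p, q, hR, hp, hq, h⟩ | ⟨p, p', -, h⟩ |
    ⟨q, q', -, h⟩
  · exact .inr (.inl rfl)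
  · rcases h with ⟨rfl, rfl⟩ | ⟨rfl, rfl⟩ | ⟨rfl, rfl⟩ | ⟨rfl, rfl⟩ | ⟨rfl, rfl⟩ | ⟨rfl, rfl⟩ |
      ⟨rfl, rfl⟩ <;>
    simp only [retractionOf_hv, retractionOf_ev, retractionOf_av, retractionOf_bv] <;>
    rcases hD p with e | e | e <;> rw [e] <;> decide
  · rcases h with ⟨rfl, rfl⟩ | ⟨rfl, rfl⟩ | ⟨rfl, rfl⟩ | ⟨rfl, rfl⟩ | ⟨rfl, rfl⟩ | ⟨rfl, rfl⟩ |
      ⟨rfl, rfl⟩ <;>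
    simp only [retractionOf_hv, retractionOf_ev, retractionOf_cv, retractionOf_dv] <;>
    rcases hD q with e | e | e <;> rw [e] <;> decide
  · simp only [retractionOf_hv, retractionOf_ev]
    rcases hD x with e | e | e <;> rw [e] <;> decide
  · rcases h with ⟨rfl, rfl⟩ | ⟨rfl, rfl⟩ <;>
    simp only [retractionOf_hv, retractionOf_ev, retractionOf_cv] <;>
    rcases h1 p q hR with ⟨e, e'⟩ | ⟨e, e'⟩ | ⟨e, e'⟩ | ⟨e, e'⟩ <;> simp only [e, e'] <;> decide
  · rcases h with ⟨rfl, rfl⟩ | ⟨rfl, rfl⟩ <;>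
    simp only [retractionOf_hv, retractionOf_ev, retractionOf_bv] <;>
    rcases h2 p q hR with ⟨e, e'⟩ | ⟨e, e'⟩ | ⟨e, e'⟩ | ⟨e, e'⟩ <;> simp only [e, e'] <;> decide
  · rcases h with ⟨rfl, rfl⟩ | ⟨rfl, rfl⟩ | ⟨rfl, rfl⟩ <;>
    simp only [retractionOf_hv, retractionOf_ev, retractionOf_av, retractionOf_cv] <;>
    rcases h3 p q hR with ⟨e, e'⟩ | ⟨e, e'⟩ | ⟨e, e'⟩ <;> simp only [e, e'] <;> decide
  · rcases h with ⟨rfl, rfl⟩ | ⟨rfl, rfl⟩ | ⟨rfl, rfl⟩ <;>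
    simp only [retractionOf_hv, retractionOf_ev, retractionOf_bv, retractionOf_dv] <;>
    rcases h4 p q hR with ⟨e, e'⟩ | ⟨e, e'⟩ | ⟨e, e'⟩ <;> simp only [e, e'] <;> decide
  · rcases h with ⟨rfl, rfl⟩ | ⟨rfl, rfl⟩ <;>
    simp only [retractionOf_av, retractionOf_bv] <;> split_ifs <;> decide
  · rcases h with ⟨rfl, rfl⟩ | ⟨rfl, rfl⟩ <;>
    simp only [retractionOf_cv, retractionOf_dv] <;> split_ifs <;> decide

/-- If an instance admits a homomorphism to the structure `D`, then its
D-graph retracts to the reflexive 4-cycle `H`. -/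
theorem stmt6 (α : Type) [Fintype α] (I : Inst α)
    (f : α → ℕ) (hf : InstHom I f) :
    ∃ g : DVert I → ZMod 4, DRetr I g := by
  refine ⟨retractionOf I f, fun u v huv => ?_, retractionOf_hv I f⟩
  rcases ((SimpleGraph.fromRel_adj _ _ _).1 huv).2 with h | h
  · exact reflC4_retractionOf_of_dBase hf h
  · exact (reflC4_retractionOf_of_dBase hf h).symm

end Paper
end

section
/- Let A=(A;R1,R2,R3,R4) be an instance, G its D-graph, and G'' the semi-compactor of G. Then G'' is connected and has diameter exactly 2; that is, G'' is not a complete graph, and any two distinct non-adjacent vertices of G'' have a common neighbor. -/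
namespace Paper

variable {α : Type}

/-- The ordered pairs `(v,v')` of non-`H` vertices of the D-graph for which an
`x`-vertex `x_{v,v'}` is created in the semi-compactor. -/
def XPairs (I : Inst α) : Set (Core I × Core I) :=
  {pr : Core I × Core I |
    (∃ p : ↥I.L, pr = (ca I p, ce I ↑p) ∨ pr = (ce I ↑p, cb I p) ∨
      pr = (ca I p, cb I p)) ∨
    (∃ q : ↥I.Rs, pr = (ce I ↑q, cc I q) ∨ pr = (ce I ↑q, cd I q) ∨
      pr = (cd I q, cc I q)) ∨
    (∃ p q, (p, q) ∈ I.R1 ∧ ∃ hq : q ∈ I.Rs, pr = (ce I p, cc I ⟨q, hq⟩)) ∨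
    (∃ p q, (p, q) ∈ I.R2 ∧ ∃ hp : p ∈ I.L, pr = (ce I q, cb I ⟨p, hp⟩)) ∨
    (∃ p q, (p, q) ∈ I.R3 ∧ ∃ hp : p ∈ I.L, ∃ hq : q ∈ I.Rs,
      pr = (ca I ⟨p, hp⟩, cc I ⟨q, hq⟩)) ∨
    (∃ p q, (p, q) ∈ I.R4 ∧ ∃ hp : p ∈ I.L, ∃ hq : q ∈ I.Rs,
      pr = (cd I ⟨q, hq⟩, cb I ⟨p, hp⟩))}

/-- The vertex set of the semi-compactor `G''`: the vertices of the D-graph,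
vertices `u_v, w_v, y_v` for every non-`H` vertex `v`, and the `x`-vertices. -/
abbrev SVert (I : Inst α) : Type := DVert I ⊕ Core I ⊕ Core I ⊕ Core I ⊕ ↥(XPairs I)

/-- A vertex of the D-graph viewed inside the semi-compactor. -/
def sg (I : Inst α) (v : DVert I) : SVert I := Sum.inl v
/-- The vertex `u_v`. -/
def su (I : Inst α) (v : Core I) : SVert I := Sum.inr (Sum.inl v)
/-- The vertex `w_v`. -/
def sw (I : Inst α) (v : Core I) : SVert I := Sum.inr (Sum.inr (Sum.inl v))
/-- The vertex `y_v`. -/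
def sy (I : Inst α) (v : Core I) : SVert I := Sum.inr (Sum.inr (Sum.inr (Sum.inl v)))
/-- The vertex `x_{v,v'}`. -/
def sx (I : Inst α) (e : ↥(XPairs I)) : SVert I := Sum.inr (Sum.inr (Sum.inr (Sum.inr e)))

/-- The (directed) list of edges of the semi-compactor `G''`. -/
def sBase (I : Inst α) : SVert I → SVert I → Prop := fun s t =>
  (∃ u v : DVert I, dBase I u v ∧ s = sg I u ∧ t = sg I v) ∨
  (∃ v : Core I,
    (s = su I v ∧ t = sg I (hv I 0)) ∨ (s = su I v ∧ t = sg I (hv I 1)) ∨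
    (s = sy I v ∧ t = sg I (hv I 0)) ∨ (s = sy I v ∧ t = sg I (hv I 2)) ∨
    (s = sw I v ∧ t = sg I (hv I 2)) ∨ (s = sw I v ∧ t = sg I (hv I 3)) ∨
    (s = su I v ∧ t = sg I (Sum.inr v)) ∨ (s = su I v ∧ t = sw I v) ∨
    (s = su I v ∧ t = sy I v) ∨ (s = sg I (Sum.inr v) ∧ t = sw I v) ∨
    (s = sw I v ∧ t = sy I v)) ∨
  (∃ v v' : Core I, v ≠ v' ∧
    ((s = su I v ∧ t = su I v') ∨ (s = sw I v ∧ t = sw I v'))) ∨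
  (∃ e : ↥(XPairs I),
    (s = sx I e ∧ t = sg I (Sum.inr e.val.1)) ∨
    (s = sx I e ∧ t = sg I (Sum.inr e.val.2)) ∨
    (s = sx I e ∧ t = su I e.val.1) ∨
    (s = sx I e ∧ t = sw I e.val.2) ∨
    (s = sx I e ∧ t = sg I (hv I 0)) ∨ (s = sx I e ∧ t = sg I (hv I 2)))

/-- The semi-compactor `G''` of the D-graph of `I`. -/
def SGraph (I : Inst α) : SimpleGraph (SVert I) := SimpleGraph.fromRel (sBase I)

/-- A retraction from the semi-compactor to `H`: a homomorphism fixing `h0,…,h3`. -/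
def SRetr (I : Inst α) (g : SVert I → ZMod 4) : Prop :=
  IsHomC4 (SGraph I) g ∧ ∀ i : ZMod 4, g (sg I (hv I i)) = i

/-- A compaction from a simple graph `G` to the reflexive 4-cycle `H`:
a homomorphism such that every cycle edge of `H` is the image of an edge. -/
def IsCompactionC4 {V : Type} (G : SimpleGraph V) (f : V → ZMod 4) : Prop :=
  IsHomC4 G f ∧ ∀ x y : ZMod 4, C4adj x y → ∃ u v : V, G.Adj u v ∧ f u = x ∧ f v = y

variable {I : Inst α}

theorem sGraph_adj_of_sBase {s t : SVert I} (h : sBase I s t) (hne : s ≠ t) :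
    (SGraph I).Adj s t :=
  (SimpleGraph.fromRel_adj _ _ _).2 ⟨hne, Or.inl h⟩

theorem sGraph_adj_of_dBase {u v : DVert I} (h : dBase I u v) (hne : u ≠ v) :
    (SGraph I).Adj (sg I u) (sg I v) :=
  sGraph_adj_of_sBase (Or.inl ⟨u, v, h, rfl, rfl⟩) fun e => hne (Sum.inl_injective e)

/-! ### Edges between the additional vertices and the rest -/

theorem su_adj_hv_zero (v : Core I) : (SGraph I).Adj (su I v) (sg I (hv I 0)) :=
  sGraph_adj_of_sBase (Or.inr <| Or.inl ⟨v, by tauto⟩) (by simp [su, sg])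

theorem su_adj_hv_one (v : Core I) : (SGraph I).Adj (su I v) (sg I (hv I 1)) :=
  sGraph_adj_of_sBase (Or.inr <| Or.inl ⟨v, by tauto⟩) (by simp [su, sg])

theorem sy_adj_hv_zero (v : Core I) : (SGraph I).Adj (sy I v) (sg I (hv I 0)) :=
  sGraph_adj_of_sBase (Or.inr <| Or.inl ⟨v, by tauto⟩) (by simp [sy, sg])

theorem sy_adj_hv_two (v : Core I) : (SGraph I).Adj (sy I v) (sg I (hv I 2)) :=
  sGraph_adj_of_sBase (Or.inr <| Or.inl ⟨v, by tauto⟩) (by simp [sy, sg])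

theorem sw_adj_hv_two (v : Core I) : (SGraph I).Adj (sw I v) (sg I (hv I 2)) :=
  sGraph_adj_of_sBase (Or.inr <| Or.inl ⟨v, by tauto⟩) (by simp [sw, sg])

theorem sw_adj_hv_three (v : Core I) : (SGraph I).Adj (sw I v) (sg I (hv I 3)) :=
  sGraph_adj_of_sBase (Or.inr <| Or.inl ⟨v, by tauto⟩) (by simp [sw, sg])

theorem su_adj_core (v : Core I) : (SGraph I).Adj (su I v) (sg I (Sum.inr v)) :=
  sGraph_adj_of_sBase (Or.inr <| Or.inl ⟨v, by tauto⟩) (by simp [su, sg])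

theorem su_adj_sw (v : Core I) : (SGraph I).Adj (su I v) (sw I v) :=
  sGraph_adj_of_sBase (Or.inr <| Or.inl ⟨v, by tauto⟩) (by simp [su, sw])

theorem su_adj_sy (v : Core I) : (SGraph I).Adj (su I v) (sy I v) :=
  sGraph_adj_of_sBase (Or.inr <| Or.inl ⟨v, by tauto⟩) (by simp [su, sy])

theorem core_adj_sw (v : Core I) : (SGraph I).Adj (sg I (Sum.inr v)) (sw I v) :=
  sGraph_adj_of_sBase (Or.inr <| Or.inl ⟨v, by simp⟩) (by simp [sg, sw])

theorem sw_adj_sy (v : Core I) : (SGraph I).Adj (sw I v) (sy I v) :=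
  sGraph_adj_of_sBase (Or.inr <| Or.inl ⟨v, by tauto⟩) (by simp [sw, sy])

theorem su_adj_su {v v' : Core I} (h : v ≠ v') : (SGraph I).Adj (su I v) (su I v') :=
  sGraph_adj_of_sBase (Or.inr <| Or.inr <| Or.inl ⟨v, v', h, by tauto⟩) (by simpa [su] using h)

theorem sw_adj_sw {v v' : Core I} (h : v ≠ v') : (SGraph I).Adj (sw I v) (sw I v') :=
  sGraph_adj_of_sBase (Or.inr <| Or.inr <| Or.inl ⟨v, v', h, by tauto⟩) (by simpa [sw] using h)

theorem sx_adj_su (e : XPairs I) : (SGraph I).Adj (sx I e) (su I e.val.1) :=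
  sGraph_adj_of_sBase (Or.inr <| Or.inr <| Or.inr ⟨e, by tauto⟩) (by simp [sx, su])

theorem sx_adj_sw (e : XPairs I) : (SGraph I).Adj (sx I e) (sw I e.val.2) :=
  sGraph_adj_of_sBase (Or.inr <| Or.inr <| Or.inr ⟨e, by tauto⟩) (by simp [sx, sw])

theorem sx_adj_hv_zero (e : XPairs I) : (SGraph I).Adj (sx I e) (sg I (hv I 0)) :=
  sGraph_adj_of_sBase (Or.inr <| Or.inr <| Or.inr ⟨e, by tauto⟩) (by simp [sx, sg])

theorem sx_adj_hv_two (e : XPairs I) : (SGraph I).Adj (sx I e) (sg I (hv I 2)) :=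
  sGraph_adj_of_sBase (Or.inr <| Or.inr <| Or.inr ⟨e, by tauto⟩) (by simp [sx, sg])

/-! ### Edges of the D-graph -/

theorem hv_adj_hv_succ (i : ZMod 4) :
    (SGraph I).Adj (sg I (hv I i)) (sg I (hv I (i + 1))) :=
  sGraph_adj_of_dBase (Or.inl ⟨i, rfl, rfl⟩) fun e => by
    have h : i = i + 1 := Sum.inl_injective e
    clear e; revert i; decide

theorem av_adj_bv (p : I.L) : (SGraph I).Adj (sg I (av I p)) (sg I (bv I p)) :=
  sGraph_adj_of_dBase (Or.inr <| Or.inl ⟨p, by tauto⟩) (by simp [av, bv, ca, cb])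

theorem av_adj_hv_zero (p : I.L) : (SGraph I).Adj (sg I (av I p)) (sg I (hv I 0)) :=
  sGraph_adj_of_dBase (Or.inr <| Or.inl ⟨p, by tauto⟩) (by simp [av, hv])

theorem av_adj_hv_three (p : I.L) : (SGraph I).Adj (sg I (av I p)) (sg I (hv I 3)) :=
  sGraph_adj_of_dBase (Or.inr <| Or.inl ⟨p, by tauto⟩) (by simp [av, hv])

theorem bv_adj_ev (p : I.L) : (SGraph I).Adj (sg I (bv I p)) (sg I (ev I p)) :=
  sGraph_adj_of_dBase (Or.inr <| Or.inl ⟨p, by tauto⟩) (by simp [bv, ev, cb, ce])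

theorem bv_adj_hv_one (p : I.L) : (SGraph I).Adj (sg I (bv I p)) (sg I (hv I 1)) :=
  sGraph_adj_of_dBase (Or.inr <| Or.inl ⟨p, by tauto⟩) (by simp [bv, hv])

theorem bv_adj_hv_two (p : I.L) : (SGraph I).Adj (sg I (bv I p)) (sg I (hv I 2)) :=
  sGraph_adj_of_dBase (Or.inr <| Or.inl ⟨p, by tauto⟩) (by simp [bv, hv])

theorem cv_adj_ev (q : I.Rs) : (SGraph I).Adj (sg I (cv I q)) (sg I (ev I q)) :=
  sGraph_adj_of_dBase (Or.inr <| Or.inr <| Or.inl ⟨q, by tauto⟩) (by simp [cv, ev, cc, ce])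

theorem cv_adj_dv (q : I.Rs) : (SGraph I).Adj (sg I (cv I q)) (sg I (dv I q)) :=
  sGraph_adj_of_dBase (Or.inr <| Or.inr <| Or.inl ⟨q, by tauto⟩) (by simp [cv, dv, cc, cd])

theorem cv_adj_hv_two (q : I.Rs) : (SGraph I).Adj (sg I (cv I q)) (sg I (hv I 2)) :=
  sGraph_adj_of_dBase (Or.inr <| Or.inr <| Or.inl ⟨q, by tauto⟩) (by simp [cv, hv])

theorem cv_adj_hv_three (q : I.Rs) : (SGraph I).Adj (sg I (cv I q)) (sg I (hv I 3)) :=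
  sGraph_adj_of_dBase (Or.inr <| Or.inr <| Or.inl ⟨q, by tauto⟩) (by simp [cv, hv])

theorem dv_adj_hv_zero (q : I.Rs) : (SGraph I).Adj (sg I (dv I q)) (sg I (hv I 0)) :=
  sGraph_adj_of_dBase (Or.inr <| Or.inr <| Or.inl ⟨q, by tauto⟩) (by simp [dv, hv])

theorem dv_adj_hv_one (q : I.Rs) : (SGraph I).Adj (sg I (dv I q)) (sg I (hv I 1)) :=
  sGraph_adj_of_dBase (Or.inr <| Or.inr <| Or.inl ⟨q, by tauto⟩) (by simp [dv, hv])

theorem ev_adj_hv_zero (a : α) : (SGraph I).Adj (sg I (ev I a)) (sg I (hv I 0)) :=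
  (sGraph_adj_of_dBase (Or.inr <| Or.inr <| Or.inr <| Or.inl ⟨a, rfl, rfl⟩)
    (by simp [ev, hv])).symm

theorem bv_adj_bv {p p' : I.L} (h : p ≠ p') :
    (SGraph I).Adj (sg I (bv I p)) (sg I (bv I p')) :=
  sGraph_adj_of_dBase (Or.inr <| Or.inr <| Or.inr <| Or.inr <| Or.inr <| Or.inr <| Or.inr <|
    Or.inr <| Or.inl ⟨p, p', h, by tauto⟩) (by simpa [bv, cb] using h)

theorem cv_adj_cv {q q' : I.Rs} (h : q ≠ q') :
    (SGraph I).Adj (sg I (cv I q)) (sg I (cv I q')) :=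
  sGraph_adj_of_dBase (Or.inr <| Or.inr <| Or.inr <| Or.inr <| Or.inr <| Or.inr <| Or.inr <|
    Or.inr <| Or.inr ⟨q, q', h, by tauto⟩) (by simpa [cv, cc] using h)

theorem dv_adj_dv {q q' : I.Rs} (h : q ≠ q') :
    (SGraph I).Adj (sg I (dv I q)) (sg I (dv I q')) :=
  sGraph_adj_of_dBase (Or.inr <| Or.inr <| Or.inr <| Or.inr <| Or.inr <| Or.inr <| Or.inr <|
    Or.inr <| Or.inr ⟨q, q', h, by tauto⟩) (by simpa [dv, cd] using h)

theorem core_adj_hv_zero_or_two (v : Core I) :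
    (SGraph I).Adj (sg I (Sum.inr v)) (sg I (hv I 0)) ∨
      (SGraph I).Adj (sg I (Sum.inr v)) (sg I (hv I 2)) := by
  rcases v with a | p | p | q | q
  exacts [Or.inl (ev_adj_hv_zero a), Or.inl (av_adj_hv_zero p), Or.inr (bv_adj_hv_two p),
    Or.inr (cv_adj_hv_two q), Or.inl (dv_adj_hv_zero q)]

/-- An element that is a second coordinate is adjacent to `h2` unless this is caused by a pair of
`R2`, and then it is adjacent to a `b`-vertex. -/
theorem ev_adj_hv_two_or_bv_of_mem_Rs {r : α} (hr : r ∈ I.Rs) :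
    (SGraph I).Adj (sg I (ev I r)) (sg I (hv I 2)) ∨
      ∃ p : I.L, (SGraph I).Adj (sg I (bv I p)) (sg I (ev I r)) := by
  obtain ⟨p, h⟩ := id hr
  have hp : p ∈ I.L := ⟨r, h⟩
  rcases h with ((h | h) | h) | h
  · exact Or.inl <| sGraph_adj_of_dBase (Or.inr <| Or.inr <| Or.inr <| Or.inr <| Or.inl
      ⟨p, r, h, hr, by tauto⟩) (by simp [ev, hv])
  · exact Or.inr ⟨⟨p, hp⟩, sGraph_adj_of_dBase (Or.inr <| Or.inr <| Or.inr <| Or.inr <| Or.inr <|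
      Or.inl ⟨p, r, h, hp, by tauto⟩) (by simp [ev, bv, ce, cb])⟩
  · exact Or.inl <| sGraph_adj_of_dBase (Or.inr <| Or.inr <| Or.inr <| Or.inr <| Or.inr <|
      Or.inr <| Or.inl ⟨p, r, h, hp, hr, by tauto⟩) (by simp [ev, hv])
  · exact Or.inl <| sGraph_adj_of_dBase (Or.inr <| Or.inr <| Or.inr <| Or.inr <| Or.inr <|
      Or.inr <| Or.inr <| Or.inl ⟨p, r, h, hp, hr, by tauto⟩) (by simp [ev, hv])

/-- An element that is a first coordinate is adjacent to `h2` unless this is caused by a pair of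
`R1`, and then it is adjacent to a `c`-vertex. -/
theorem ev_adj_hv_two_or_cv_of_mem_L {r : α} (hr : r ∈ I.L) :
    (SGraph I).Adj (sg I (ev I r)) (sg I (hv I 2)) ∨
      ∃ q : I.Rs, (SGraph I).Adj (sg I (cv I q)) (sg I (ev I r)) := by
  obtain ⟨q, h⟩ := id hr
  have hq : q ∈ I.Rs := ⟨r, h⟩
  rcases h with ((h | h) | h) | h
  · exact Or.inr ⟨⟨q, hq⟩, sGraph_adj_of_dBase (Or.inr <| Or.inr <| Or.inr <| Or.inr <| Or.inl
      ⟨r, q, h, hq, by tauto⟩) (by simp [ev, cv, ce, cc])⟩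
  · exact Or.inl <| sGraph_adj_of_dBase (Or.inr <| Or.inr <| Or.inr <| Or.inr <| Or.inr <|
      Or.inl ⟨r, q, h, hr, by tauto⟩) (by simp [ev, hv])
  · exact Or.inl <| sGraph_adj_of_dBase (Or.inr <| Or.inr <| Or.inr <| Or.inr <| Or.inr <|
      Or.inr <| Or.inl ⟨r, q, h, hr, hq, by tauto⟩) (by simp [ev, hv])
  · exact Or.inl <| sGraph_adj_of_dBase (Or.inr <| Or.inr <| Or.inr <| Or.inr <| Or.inr <|
      Or.inr <| Or.inr <| Or.inl ⟨r, q, h, hr, hq, by tauto⟩) (by simp [ev, hv])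

theorem ev_adj_hv_two_or_bv (r : α) :
    (SGraph I).Adj (sg I (ev I r)) (sg I (hv I 2)) ∨
      ∃ p : I.L, (SGraph I).Adj (sg I (bv I p)) (sg I (ev I r)) :=
  (I.cover r).elim (fun h => Or.inr ⟨⟨r, h⟩, bv_adj_ev _⟩) ev_adj_hv_two_or_bv_of_mem_Rs

theorem ev_adj_hv_two_or_cv (r : α) :
    (SGraph I).Adj (sg I (ev I r)) (sg I (hv I 2)) ∨
      ∃ q : I.Rs, (SGraph I).Adj (sg I (cv I q)) (sg I (ev I r)) :=
  (I.cover r).elim ev_adj_hv_two_or_cv_of_mem_L fun h => Or.inr ⟨⟨r, h⟩, cv_adj_ev _⟩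

/-! ### Pairs of vertices at distance at most two -/

/-- Two vertices of a graph are close if their distance is at most two. -/
def Close {V : Type*} (G : SimpleGraph V) (s t : V) : Prop :=
  s = t ∨ G.Adj s t ∨ ∃ r, G.Adj s r ∧ G.Adj t r

namespace Close

variable {V : Type*} {G : SimpleGraph V} {r s t : V}

theorem symm (h : Close G s t) : Close G t s := by
  rcases h with h | h | ⟨r, h, h'⟩
  exacts [Or.inl h.symm, Or.inr (Or.inl h.symm), Or.inr (Or.inr ⟨r, h', h⟩)]

theorem of_adj (h : G.Adj s t) : Close G s t := Or.inr (Or.inl h)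

theorem of_adj_adj (h : G.Adj s r) (h' : G.Adj t r) : Close G s t := Or.inr (Or.inr ⟨r, h, h'⟩)

theorem reachable (h : Close G s t) : G.Reachable s t := by
  rcases h with rfl | h | ⟨r, h, h'⟩
  exacts [.refl _, h.reachable, h.reachable.trans h'.symm.reachable]

/-- A neighbour of a member of a clique is close to all members of the clique. -/
theorem of_pairwise_adj {ι : Type*} {f : ι → V} (hf : ∀ i j, i ≠ j → G.Adj (f i) (f j)) {i : ι}
    (h : G.Adj s (f i)) (j : ι) : Close G s (f j) := by
  rcases eq_or_ne i j with rfl | hij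
  exacts [of_adj h, of_adj_adj h (hf j i hij.symm)]

theorem of_clique {ι : Type*} {f : ι → V} (hf : ∀ i j, i ≠ j → G.Adj (f i) (f j)) (i j : ι) :
    Close G (f i) (f j) := by
  rcases eq_or_ne i j with rfl | hij
  exacts [Or.inl rfl, of_adj (hf i j hij)]

end Close

theorem close_hv_hv (i j : ZMod 4) : Close (SGraph I) (sg I (hv I i)) (sg I (hv I j)) := by
  have h : j = i ∨ j = i + 1 ∨ i = j + 1 ∨ j = i + 1 + 1 := by
    revert i j; decide
  rcases h with rfl | rfl | rfl | rfl
  exacts [Or.inl rfl, .of_adj (hv_adj_hv_succ _), .of_adj (hv_adj_hv_succ _).symm,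
    .of_adj_adj (hv_adj_hv_succ _) (hv_adj_hv_succ _).symm]

theorem close_hv_of_adj_su_sw {s : SVert I} {v w : Core I} (hu : (SGraph I).Adj s (su I v))
    (hw : (SGraph I).Adj s (sw I w)) (i : ZMod 4) : Close (SGraph I) s (sg I (hv I i)) := by
  have h : i = 0 ∨ i = 1 ∨ i = 2 ∨ i = 3 := by revert i; decide
  rcases h with rfl | rfl | rfl | rfl
  exacts [.of_adj_adj hu (su_adj_hv_zero v).symm, .of_adj_adj hu (su_adj_hv_one v).symm,
    .of_adj_adj hw (sw_adj_hv_two w).symm, .of_adj_adj hw (sw_adj_hv_three w).symm]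

theorem close_su_hv (v : Core I) (i : ZMod 4) :
    Close (SGraph I) (su I v) (sg I (hv I i)) := by
  have h : i = 0 ∨ i = 1 ∨ i = 2 ∨ i = 3 := by revert i; decide
  rcases h with rfl | rfl | rfl | rfl
  exacts [.of_adj (su_adj_hv_zero v), .of_adj (su_adj_hv_one v),
    .of_adj_adj (su_adj_sw v) (sw_adj_hv_two v).symm,
    .of_adj_adj (su_adj_sw v) (sw_adj_hv_three v).symm]

theorem close_sw_hv (v : Core I) (i : ZMod 4) :
    Close (SGraph I) (sw I v) (sg I (hv I i)) := by
  have h : i = 0 ∨ i = 1 ∨ i = 2 ∨ i = 3 := by revert i; decide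
  rcases h with rfl | rfl | rfl | rfl
  exacts [.of_adj_adj (su_adj_sw v).symm (su_adj_hv_zero v).symm,
    .of_adj_adj (su_adj_sw v).symm (su_adj_hv_one v).symm,
    .of_adj (sw_adj_hv_two v), .of_adj (sw_adj_hv_three v)]

theorem close_ev_bv (r : α) (p : I.L) : Close (SGraph I) (sg I (ev I r)) (sg I (bv I p)) := by
  rcases ev_adj_hv_two_or_bv (I := I) r with h | ⟨p', h⟩
  exacts [.of_adj_adj h (bv_adj_hv_two p),
    .of_pairwise_adj (f := fun p => sg I (bv I p)) (fun _ _ => bv_adj_bv) h.symm p]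

theorem close_ev_cv (r : α) (q : I.Rs) : Close (SGraph I) (sg I (ev I r)) (sg I (cv I q)) := by
  rcases ev_adj_hv_two_or_cv (I := I) r with h | ⟨q', h⟩
  exacts [.of_adj_adj h (cv_adj_hv_two q),
    .of_pairwise_adj (f := fun q => sg I (cv I q)) (fun _ _ => cv_adj_cv) h.symm q]

theorem close_av_bv (p p' : I.L) : Close (SGraph I) (sg I (av I p)) (sg I (bv I p')) :=
  .of_pairwise_adj (f := fun p => sg I (bv I p)) (fun _ _ => bv_adj_bv) (av_adj_bv p) p'

theorem close_cv_dv (q q' : I.Rs) : Close (SGraph I) (sg I (cv I q)) (sg I (dv I q')) :=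
  .of_pairwise_adj (f := fun q => sg I (dv I q)) (fun _ _ => dv_adj_dv) (cv_adj_dv q) q'

theorem close_core_core (v v' : Core I) :
    Close (SGraph I) (sg I (Sum.inr v)) (sg I (Sum.inr v')) := by
  rcases v with a | p | p | q | q <;> rcases v' with a' | p' | p' | q' | q'
  · exact .of_adj_adj (ev_adj_hv_zero a) (ev_adj_hv_zero a')
  · exact .of_adj_adj (ev_adj_hv_zero a) (av_adj_hv_zero p')
  · exact close_ev_bv a p'
  · exact close_ev_cv a q'
  · exact .of_adj_adj (ev_adj_hv_zero a) (dv_adj_hv_zero q')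
  · exact .of_adj_adj (av_adj_hv_zero p) (ev_adj_hv_zero a')
  · exact .of_adj_adj (av_adj_hv_zero p) (av_adj_hv_zero p')
  · exact close_av_bv p p'
  · exact .of_adj_adj (av_adj_hv_three p) (cv_adj_hv_three q')
  · exact .of_adj_adj (av_adj_hv_zero p) (dv_adj_hv_zero q')
  · exact (close_ev_bv a' p).symm
  · exact (close_av_bv p' p).symm
  · exact .of_adj_adj (bv_adj_hv_two p) (bv_adj_hv_two p')
  · exact .of_adj_adj (bv_adj_hv_two p) (cv_adj_hv_two q')
  · exact .of_adj_adj (bv_adj_hv_one p) (dv_adj_hv_one q')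
  · exact (close_ev_cv a' q).symm
  · exact .of_adj_adj (cv_adj_hv_three q) (av_adj_hv_three p')
  · exact .of_adj_adj (cv_adj_hv_two q) (bv_adj_hv_two p')
  · exact .of_adj_adj (cv_adj_hv_two q) (cv_adj_hv_two q')
  · exact close_cv_dv q q'
  · exact .of_adj_adj (dv_adj_hv_zero q) (ev_adj_hv_zero a')
  · exact .of_adj_adj (dv_adj_hv_zero q) (av_adj_hv_zero p')
  · exact .of_adj_adj (dv_adj_hv_one q) (bv_adj_hv_one p')
  · exact (close_cv_dv q' q).symm
  · exact .of_adj_adj (dv_adj_hv_zero q) (dv_adj_hv_zero q')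

theorem close_su_of_adj_su {s : SVert I} {v : Core I} (h : (SGraph I).Adj s (su I v))
    (v' : Core I) : Close (SGraph I) s (su I v') :=
  .of_pairwise_adj (fun _ _ => su_adj_su) h v'

theorem close_sw_of_adj_sw {s : SVert I} {v : Core I} (h : (SGraph I).Adj s (sw I v))
    (v' : Core I) : Close (SGraph I) s (sw I v') :=
  .of_pairwise_adj (fun _ _ => sw_adj_sw) h v'

theorem close_core_of_adj_hv {t : SVert I} (h₀ : (SGraph I).Adj t (sg I (hv I 0)))
    (h₂ : (SGraph I).Adj t (sg I (hv I 2))) (v : Core I) :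
    Close (SGraph I) (sg I (Sum.inr v)) t :=
  (core_adj_hv_zero_or_two v).elim (fun h => .of_adj_adj h h₀) fun h => .of_adj_adj h h₂

theorem close_sGraph (s t : SVert I) : Close (SGraph I) s t := by
  have core_hv (v : Core I) := close_hv_of_adj_su_sw (su_adj_core v).symm (core_adj_sw v)
  have sy_hv (v : Core I) := close_hv_of_adj_su_sw (su_adj_sy v).symm (sw_adj_sy v).symm
  have sx_hv (e : XPairs I) := close_hv_of_adj_su_sw (sx_adj_su e) (sx_adj_sw e)
  have core_su (v : Core I) := close_su_of_adj_su (su_adj_core v).symm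
  have core_sw (v : Core I) := close_sw_of_adj_sw (core_adj_sw v)
  have core_sy (v v' : Core I) := close_core_of_adj_hv (sy_adj_hv_zero v') (sy_adj_hv_two v') v
  have core_sx (v : Core I) (e : XPairs I) :=
    close_core_of_adj_hv (sx_adj_hv_zero e) (sx_adj_hv_two e) v
  have su_sw (v : Core I) := close_sw_of_adj_sw (su_adj_sw v)
  rcases s with (i | v) | v | v | v | e <;> rcases t with (j | v') | v' | v' | v' | e'
  · exact close_hv_hv i j
  · exact (core_hv v' i).symm
  · exact (close_su_hv v' i).symm
  · exact (close_sw_hv v' i).symm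
  · exact (sy_hv v' i).symm
  · exact (sx_hv e' i).symm
  · exact core_hv v j
  · exact close_core_core v v'
  · exact core_su v v'
  · exact core_sw v v'
  · exact core_sy v v'
  · exact core_sx v e'
  · exact close_su_hv v j
  · exact (core_su v' v).symm
  · exact .of_clique (fun _ _ => su_adj_su) v v'
  · exact su_sw v v'
  · exact .of_adj_adj (su_adj_hv_zero v) (sy_adj_hv_zero v')
  · exact .of_adj_adj (su_adj_hv_zero v) (sx_adj_hv_zero e')
  · exact close_sw_hv v j
  · exact (core_sw v' v).symm
  · exact (su_sw v' v).symm
  · exact .of_clique (fun _ _ => sw_adj_sw) v v'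
  · exact .of_adj_adj (sw_adj_hv_two v) (sy_adj_hv_two v')
  · exact .of_adj_adj (sw_adj_hv_two v) (sx_adj_hv_two e')
  · exact sy_hv v j
  · exact (core_sy v' v).symm
  · exact .of_adj_adj (sy_adj_hv_zero v) (su_adj_hv_zero v')
  · exact .of_adj_adj (sy_adj_hv_two v) (sw_adj_hv_two v')
  · exact .of_adj_adj (sy_adj_hv_zero v) (sy_adj_hv_zero v')
  · exact .of_adj_adj (sy_adj_hv_zero v) (sx_adj_hv_zero e')
  · exact sx_hv e j
  · exact (core_sx v' e).symm
  · exact .of_adj_adj (sx_adj_hv_zero e) (su_adj_hv_zero v')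
  · exact .of_adj_adj (sx_adj_hv_two e) (sw_adj_hv_two v')
  · exact .of_adj_adj (sx_adj_hv_zero e) (sy_adj_hv_zero v')
  · exact .of_adj_adj (sx_adj_hv_zero e) (sx_adj_hv_zero e')

theorem not_adj_hv_zero_hv_two : ¬ (SGraph I).Adj (sg I (hv I 0)) (sg I (hv I 2)) := by
  have h₁ : (2 : ZMod 4) ≠ 1 := by decide
  have h₂ : (0 : ZMod 4) ≠ 2 + 1 := by decide
  simp [SGraph, SimpleGraph.fromRel_adj, sBase, dBase, sg, su, sw, sy, sx, hv, ev, av, bv, cv, dv,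
    h₁, h₂]

/-- The semi-compactor of the D-graph of any instance is connected and has
diameter exactly 2: it is not complete, and any two distinct non-adjacent
vertices have a common neighbour. -/
theorem stmt9 (α : Type) [Fintype α] (I : Inst α) :
    (SGraph I).Connected ∧
    (¬ ∀ s t : SVert I, s ≠ t → (SGraph I).Adj s t) ∧
    (∀ s t : SVert I, s ≠ t → ¬ (SGraph I).Adj s t →
      ∃ r : SVert I, (SGraph I).Adj s r ∧ (SGraph I).Adj t r) := by
  have : Nonempty (SVert I) := ⟨sg I (hv I 0)⟩
  refine ⟨⟨fun s t => (close_sGraph s t).reachable⟩, fun h => not_adj_hv_zero_hv_two (I := I) ?_,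
    fun s t hne hadj => ((close_sGraph s t).resolve_left hne).resolve_left hadj⟩
  refine h _ _ fun e => ?_
  have : (0 : ZMod 4) ≠ 2 := by decide
  exact this (Sum.inl_injective (Sum.inl_injective e))

end Paper
end
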